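/- Define the mosaic injection ι from n-mosaics to (n+1)-mosaics by (ι M)(i,j) = M(i,j) if i < n and j < n, and (ι M)(i,j) = T_0 (the blank tile) otherwise. Then ι is injective, and if M is a knot n-mosaic then ι M is a knot (n+1)-mosaic. -/

import Mathlib

/-- An `n`-mosaic: an `n × n` matrix of tiles, the tiles being indexed by `Fin 11`. -/
def Mosaic (n : ℕ) : Type := Fin n → Fin n → Fin 11

/-- The four edges of a tile. -/
inductive MEdge : Type
  | top
  | bottom
  | left
  | right
  deriving DecidableEq

/-- The connection points of each of the 11 tiles: `cp t e` holds iff tile `t`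
has a connection point on edge `e`. -/
def cp : Fin 11 → MEdge → Prop
  | ⟨0, _⟩, _ => False
  | ⟨1, _⟩, e => e = MEdge.left ∨ e = MEdge.bottom
  | ⟨2, _⟩, e => e = MEdge.right ∨ e = MEdge.bottom
  | ⟨3, _⟩, e => e = MEdge.top ∨ e = MEdge.right
  | ⟨4, _⟩, e => e = MEdge.top ∨ e = MEdge.left
  | ⟨5, _⟩, e => e = MEdge.left ∨ e = MEdge.right
  | ⟨6, _⟩, e => e = MEdge.top ∨ e = MEdge.bottom
  | _, _ => True

/-- A knot `n`-mosaic: every tile is suitably connected, i.e. facing edges of adjacent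
tiles agree on carrying a connection point, and no connection point lies on the outer
boundary of the mosaic.  Rows are indexed top-to-bottom, columns left-to-right. -/
def IsKnotMosaic {n : ℕ} (M : Mosaic n) : Prop :=
  (∀ (a b : Fin n) (h : b.val + 1 < n),
      (cp (M a b) MEdge.right ↔ cp (M a ⟨b.val + 1, h⟩) MEdge.left)) ∧
  (∀ (a b : Fin n) (h : a.val + 1 < n),
      (cp (M a b) MEdge.bottom ↔ cp (M ⟨a.val + 1, h⟩ b) MEdge.top)) ∧
  (∀ a b : Fin n,
      (a.val = 0 → ¬ cp (M a b) MEdge.top) ∧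
      (a.val = n - 1 → ¬ cp (M a b) MEdge.bottom) ∧
      (b.val = 0 → ¬ cp (M a b) MEdge.left) ∧
      (b.val = n - 1 → ¬ cp (M a b) MEdge.right))

/-- The mosaic injection from `n`-mosaics to `(n+1)`-mosaics: the original mosaic is
kept in the top-left `n × n` corner and the new cells are filled with the blank tile. -/
def mosaicInj {n : ℕ} (M : Mosaic n) : Mosaic (n + 1) :=
  fun i j =>
    if h : i.val < n ∧ j.val < n then M ⟨i.val, h.1⟩ ⟨j.val, h.2⟩ else (0 : Fin 11)

theorem not_cp_zero (e : MEdge) : ¬ cp 0 e := id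

theorem mosaicInj_of_lt {n : ℕ} (M : Mosaic n) {i j : Fin (n + 1)}
    (hi : i.val < n) (hj : j.val < n) : mosaicInj M i j = M ⟨i.val, hi⟩ ⟨j.val, hj⟩ :=
  dif_pos ⟨hi, hj⟩

theorem mosaicInj_of_not_lt {n : ℕ} (M : Mosaic n) {i j : Fin (n + 1)}
    (h : ¬ (i.val < n ∧ j.val < n)) : mosaicInj M i j = 0 :=
  dif_neg h

theorem mosaicInj_injective (n : ℕ) : Function.Injective (mosaicInj (n := n)) := by
  intro M N h
  funext i j
  have hij := congrFun (congrFun h i.castSucc) j.castSucc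
  rwa [mosaicInj_of_lt M i.isLt j.isLt, mosaicInj_of_lt N i.isLt j.isLt] at hij

/-- A connection point of `mosaicInj M` lies on a tile of the original mosaic. -/
theorem cp_mosaicInj_iff {n : ℕ} (M : Mosaic n) (i j : Fin (n + 1)) (e : MEdge) :
    cp (mosaicInj M i j) e ↔
      ∃ (hi : i.val < n) (hj : j.val < n), cp (M ⟨i.val, hi⟩ ⟨j.val, hj⟩) e := by
  by_cases h : i.val < n ∧ j.val < n
  · rw [mosaicInj_of_lt M h.1 h.2]
    exact ⟨fun hc => ⟨h.1, h.2, hc⟩, fun ⟨_, _, hc⟩ => hc⟩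
  · rw [mosaicInj_of_not_lt M h]
    exact ⟨fun hc => (not_cp_zero e hc).elim, fun ⟨hi, hj, _⟩ => (h ⟨hi, hj⟩).elim⟩

theorem IsKnotMosaic.mosaicInj {n : ℕ} {M : Mosaic n} (hM : IsKnotMosaic M) :
    IsKnotMosaic (mosaicInj M) := by
  obtain ⟨hrow, hcol, hbdry⟩ := hM
  refine ⟨fun a b h => ?_, fun a b h => ?_, fun a b => ?_⟩
  · simp only [cp_mosaicInj_iff]
    constructor
    · rintro ⟨ha, hb, hc⟩
      have hb' : b.val + 1 < n := by
        by_contra hlt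
        exact (hbdry ⟨a, ha⟩ ⟨b, hb⟩).2.2.2 (by simp only; omega) hc
      exact ⟨ha, hb', (hrow ⟨a, ha⟩ ⟨b, hb⟩ hb').1 hc⟩
    · rintro ⟨ha, hb, hc⟩
      exact ⟨ha, by omega, (hrow ⟨a, ha⟩ ⟨b, by omega⟩ hb).2 hc⟩
  · simp only [cp_mosaicInj_iff]
    constructor
    · rintro ⟨ha, hb, hc⟩
      have ha' : a.val + 1 < n := by
        by_contra hlt
        exact (hbdry ⟨a, ha⟩ ⟨b, hb⟩).2.1 (by simp only; omega) hc
      exact ⟨ha', hb, (hcol ⟨a, ha⟩ ⟨b, hb⟩ ha').1 hc⟩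
    · rintro ⟨ha, hb, hc⟩
      exact ⟨by omega, hb, (hcol ⟨a, by omega⟩ ⟨b, hb⟩ ha).2 hc⟩
  · simp only [cp_mosaicInj_iff]
    refine ⟨?_, ?_, ?_, ?_⟩
    · rintro h0 ⟨ha, hb, hc⟩
      exact (hbdry _ _).1 h0 hc
    · rintro hn ⟨ha, -, -⟩
      omega
    · rintro h0 ⟨ha, hb, hc⟩
      exact (hbdry _ _).2.2.1 h0 hc
    · rintro hn ⟨-, hb, -⟩
      omega

/-- The mosaic injection is injective and sends knot `n`-mosaics to knot
`(n+1)`-mosaics. -/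
theorem mosaicInj_injective_and_preserves_knot (n : ℕ) :
    Function.Injective (mosaicInj (n := n)) ∧
    ∀ M : Mosaic n, IsKnotMosaic M → IsKnotMosaic (mosaicInj M) :=
  ⟨mosaicInj_injective n, fun _ hM => hM.mosaicInj⟩
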